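/- For every real C > 0 and every integer m ≥ 1 there exist an integer n₀ ≥ 2 and a constant c > 0 (both depending only on C and m) with the following property. Let Γ be an m-intersecting family of n ≥ n₀ closed Jordan curves in general position in the plane, and let 𝒯 be the set of all touching points of Γ. If |𝒯| ≥ C · n^(2 − 1/(3m+15)), then there exist two distinct curves γ₁, γ₂ ∈ Γ, a connected component Δ of ℝ² \ (γ₁ ∪ γ₂), and disjoint subfamilies A, B ⊆ Γ \ {γ₁, γ₂} such that: (1) every curve in A forms a touching pair with γ₁ and every curve in B forms a touching pair with γ₂; and (2) the number of touching points that lie in Δ and are the touching point of a pair consisting of one curve of A and one curve of B is at least c · |𝒯| / n^(2/(3m+15)). -/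

import Mathlib

noncomputable section

abbrev Plane : Type := EuclideanSpace ℝ (Fin 2)

/-- A closed Jordan curve: a subset of the plane homeomorphic to the unit circle. -/
def IsJordanCurve (γ : Set Plane) : Prop :=
  Nonempty (γ ≃ₜ Metric.sphere (0 : Plane) 1)

/-- A Jordan arc: a subset of the plane homeomorphic to the closed unit interval. -/
def IsJordanArc (γ : Set Plane) : Prop :=
  Nonempty (γ ≃ₜ unitInterval)

/-- General position: any two distinct members intersect in a finite set, and no point
of the plane lies on three distinct members. -/
def GenPos {n : ℕ} (γ : Fin n → Set Plane) : Prop :=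
  (∀ i j : Fin n, i ≠ j → (γ i ∩ γ j).Finite) ∧
  (∀ p : Plane, ∀ i j k : Fin n, p ∈ γ i → p ∈ γ j → p ∈ γ k → i = j ∨ i = k ∨ j = k)

/-- `m`-intersecting: any two distinct members intersect in at most `m` points. -/
def MIntersecting {n : ℕ} (m : ℕ) (γ : Fin n → Set Plane) : Prop :=
  ∀ i j : Fin n, i ≠ j → (γ i ∩ γ j).ncard ≤ m

/-- Two curves touch if their intersection is a singleton. -/
def Touches (a b : Set Plane) : Prop := ∃ x, a ∩ b = {x}

/-- The number of touching pairs of the family. -/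
def touchingPairs {n : ℕ} (γ : Fin n → Set Plane) : ℕ :=
  {p : Fin n × Fin n | p.1 < p.2 ∧ Touches (γ p.1) (γ p.2)}.ncard

/-- The set of intersection points of the family: points lying on at least two
distinct members. -/
def interPoints {n : ℕ} (γ : Fin n → Set Plane) : Set Plane :=
  {x : Plane | ∃ i j : Fin n, i ≠ j ∧ x ∈ γ i ∧ x ∈ γ j}

/-- The set of touching points of the family: points at which some two distinct
members have a singleton intersection. -/
def touchPoints {n : ℕ} (γ : Fin n → Set Plane) : Set Plane :=
  {x : Plane | ∃ i j : Fin n, i ≠ j ∧ γ i ∩ γ j = {x}}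

theorem gc_log_exists {X : Type} [TopologicalSpace X] [SimplyConnectedSpace X]
    [LocallyPathConnectedSpace X] (f : X → ℂ) (hf : Continuous f) (h0 : ∀ x, f x ≠ 0) :
    ∃ L : X → ℂ, Continuous L ∧ ∀ x, Complex.exp (L x) = f x := by
  obtain ⟨x0⟩ : Nonempty X := inferInstance
  obtain ⟨F, ⟨_, hF⟩, _⟩ := Complex.isCoveringMapOn_exp.existsUnique_continuousMap_lifts
    ⟨f, hf⟩ (a₀ := x0) (e₀ := Complex.log (f x0)) (by simp [Complex.exp_log (h0 x0)])
    (by intro a; simpa using h0 a)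
  exact ⟨F, F.continuous, fun x => congrFun hF x⟩

theorem gc_const {S : Set ℂ} (hS : IsPreconnected S) {L₁ L₂ : ℂ → ℂ} (h1 : ContinuousOn L₁ S)
    (h2 : ContinuousOn L₂ S) (h : ∀ x ∈ S, Complex.exp (L₁ x) = Complex.exp (L₂ x))
    {x y : ℂ} (hx : x ∈ S) (hy : y ∈ S) : L₁ x - L₂ x = L₁ y - L₂ y := by
  have hpi : (0:ℝ) < 2 * Real.pi := by positivity
  set D : ℂ → ℝ := fun z => (L₁ z - L₂ z).im / (2 * Real.pi) with hD
  have hDc : ContinuousOn D S := by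
    have := Complex.continuous_im.comp_continuousOn (h1.sub h2)
    exact this.div_const _
  have key : ∀ z ∈ S, ∃ k : ℤ, L₁ z - L₂ z = k * (2 * Real.pi * Complex.I) := by
    intro z hz
    obtain ⟨k, hk⟩ := Complex.exp_eq_exp_iff_exists_int.1 (h z hz)
    exact ⟨k, by rw [hk]; ring⟩
  have key2 : ∀ z ∈ S, ∀ k : ℤ, L₁ z - L₂ z = k * (2 * Real.pi * Complex.I) → D z = k := by
    intro z hz k hk
    simp only [hD, hk]
    have : ((k:ℂ) * (2 * Real.pi * Complex.I)).im = k * (2 * Real.pi) := by simp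
    rw [this]; field_simp
  have main : ∀ x ∈ S, ∀ y ∈ S, ¬ D x < D y := by
    intro x hx y hy hlt
    obtain ⟨a, ha⟩ := key x hx
    obtain ⟨b, hb⟩ := key y hy
    have hDa := key2 x hx a ha
    have hDb := key2 y hy b hb
    have hab : a < b := by rw [hDa, hDb] at hlt; exact_mod_cast hlt
    have hab' : (a:ℝ) + 1 ≤ b := by exact_mod_cast hab
    have hmem : (a:ℝ) + 1/2 ∈ D '' S :=
      (hS.image D hDc).ordConnected.out ⟨x, hx, rfl⟩ ⟨y, hy, rfl⟩
        ⟨by rw [hDa]; linarith, by rw [hDb]; linarith⟩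
    obtain ⟨z, hz, hzz⟩ := hmem
    obtain ⟨c, hc⟩ := key z hz
    rw [key2 z hz c hc] at hzz
    have h3 : (2 * c : ℝ) = 2 * a + 1 := by linarith
    have h4 : (2 * c : ℤ) = 2 * a + 1 := by exact_mod_cast h3
    omega
  obtain ⟨a, ha⟩ := key x hx
  obtain ⟨b, hb⟩ := key y hy
  have e : D x = D y := le_antisymm (not_lt.1 (main y hy x hx)) (not_lt.1 (main x hx y hy))
  rw [key2 x hx a ha, key2 y hy b hb] at e
  have : a = b := by exact_mod_cast e
  rw [ha, hb, this]

theorem gc_closure_comp {K : Set ℂ} (hK : IsClosed K) (p : ℂ) :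
    closure (connectedComponentIn Kᶜ p) ⊆ connectedComponentIn Kᶜ p ∪ K := by
  intro z hz
  by_cases hzK : z ∈ K
  · exact Or.inr hzK
  left
  have ho : IsOpen (connectedComponentIn Kᶜ z) := hK.isOpen_compl.connectedComponentIn
  obtain ⟨w, hw1, hw2⟩ := mem_closure_iff.1 hz _ ho (mem_connectedComponentIn hzK)
  rw [connectedComponentIn_eq hw2, ← connectedComponentIn_eq hw1]
  exact mem_connectedComponentIn hzK

theorem gc_eilenberg {ι : Type} [Fintype ι] [DecidableEq ι] {K : Set ℂ} (hK : IsClosed K)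
    (p : ι → ℂ) (n : ι → ℤ) (hp : ∀ i, p i ∉ K) (i₁ : ι)
    (hb : Bornology.IsBounded (connectedComponentIn Kᶜ (p i₁)))
    (hne : ∀ i, i ≠ i₁ → p i ∉ connectedComponentIn Kᶜ (p i₁))
    (g : ℂ → ℂ) (hg : Continuous g)
    (hgK : ∀ z ∈ K, Complex.exp (g z) = ∏ i, (z - p i) ^ n i) : n i₁ = 0 := by
  classical
  set U := connectedComponentIn Kᶜ (p i₁) with hU
  set φ : ℂ → ℂ := fun z => ∏ i, (z - p i) ^ n i with hφ
  set h : ℂ → ℂ := fun z => ∏ i ∈ Finset.univ.erase i₁, (z - p i) ^ n i with hh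
  have hUo : IsOpen U := hK.isOpen_compl.connectedComponentIn
  have hpU : p i₁ ∈ U := mem_connectedComponentIn (hp i₁)
  have hcl : closure U ⊆ U ∪ K := gc_closure_comp hK _
  have hfr : frontier U ⊆ K := by
    intro z hz
    rw [hUo.frontier_eq] at hz
    rcases hcl hz.1 with h | h
    · exact absurd h hz.2
    · exact h
  have hpcl : ∀ i, i ≠ i₁ → p i ∉ closure U := by
    intro i hi hc
    rcases hcl hc with h | h
    · exact hne i hi h
    · exact hp i h
  have hnz : ∀ z ∈ closure U, z ≠ p i₁ → ∀ i, z - p i ≠ 0 := by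
    intro z hz hz1 i
    rw [sub_ne_zero]
    rintro rfl
    by_cases hi : i = i₁
    · exact hz1 (by rw [hi])
    · exact hpcl i hi hz
  set ψ : ℂ → ℂ := fun z => if z ∈ U then φ z else Complex.exp (g z) with hψ
  have hψc : ContinuousOn ψ {p i₁}ᶜ := by
    apply ContinuousOn.if
    · rintro a ⟨_, ha⟩
      exact (hgK a (hfr ha)).symm
    · refine continuousOn_finsetProd _ fun i _ => ?_
      refine ContinuousOn.zpow₀ (by fun_prop) _ ?_
      rintro z ⟨hz1, hz2⟩
      exact Or.inl (hnz z hz2 hz1 i)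
    · fun_prop
  have hψ0 : ∀ z, z ≠ p i₁ → ψ z ≠ 0 := by
    intro z hz
    simp only [hψ]
    split_ifs with hzU
    · exact Finset.prod_ne_zero_iff.2 fun i _ => zpow_ne_zero _ (hnz z (subset_closure hzU) hz i)
    · exact Complex.exp_ne_zero _
  have hpe : ∀ w : ℂ, p i₁ + Complex.exp w ≠ p i₁ := by
    intro w; simp
  obtain ⟨L, hLc, hL⟩ := gc_log_exists (fun w : ℂ => ψ (p i₁ + Complex.exp w))
    (hψc.comp_continuous (by fun_prop) (fun w => hpe w)) (fun w => hψ0 _ (hpe w))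
  have per : ∀ w : ℂ, Complex.exp (w + 2 * Real.pi * Complex.I) = Complex.exp w :=
    fun w => Complex.exp_periodic w
  -- monodromy is constant
  have mono : ∀ w w' : ℂ, L (w + 2 * Real.pi * Complex.I) - L w
      = L (w' + 2 * Real.pi * Complex.I) - L w' := by
    intro w w'
    refine gc_const (L₁ := fun w => L (w + 2 * Real.pi * Complex.I)) (L₂ := L) isPreconnected_univ
      (by fun_prop) (by fun_prop) ?_ (Set.mem_univ _) (Set.mem_univ _)
    intro x _
    simp only [hL, per]
  -- far away
  obtain ⟨R, hR0, hR⟩ := hb.subset_ball_lt 0 (p i₁)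
  have far : ∃ w : ℂ, L (w + 2 * Real.pi * Complex.I) - L w = 0 := by
    have hS : IsPreconnected {w : ℂ | Real.log R < w.re} :=
      (convex_halfSpace_re_gt _).isPreconnected
    refine ⟨((Real.log R + 1 : ℝ) : ℂ), ?_⟩
    have := gc_const (L₁ := L) (L₂ := fun w => g (p i₁ + Complex.exp w)) hS
      (by fun_prop) (by fun_prop) ?_ (x := ((Real.log R + 1 : ℝ) : ℂ) + 2 * Real.pi * Complex.I)
      (y := ((Real.log R + 1 : ℝ) : ℂ)) (by simp) (by simp)
    · simp only [per] at this
      linear_combination this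
    · intro w hw
      rw [hL]
      simp only [hψ]
      rw [if_neg]
      intro hmem
      have := hR hmem
      rw [Metric.mem_ball, dist_eq_norm, add_sub_cancel_left, Complex.norm_exp,
        ← Real.lt_log_iff_exp_lt hR0] at this
      exact absurd hw (not_lt.2 this.le)
  -- near
  have hh0 : h (p i₁) ≠ 0 := by
    refine Finset.prod_ne_zero_iff.2 fun i hi => zpow_ne_zero _ ?_
    rw [sub_ne_zero]
    intro he
    exact hne i (Finset.ne_of_mem_erase hi) (he ▸ hpU)
  have near : ∃ w : ℂ, L (w + 2 * Real.pi * Complex.I) - L w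
      = n i₁ * (2 * Real.pi * Complex.I) := by
    have hhU : ContinuousOn h U := by
      refine continuousOn_finsetProd _ fun i hi => ?_
      refine ContinuousOn.zpow₀ (by fun_prop) _ ?_
      intro z hz
      left
      rw [sub_ne_zero]
      rintro rfl
      exact hne i (Finset.ne_of_mem_erase hi) hz
    have hca : ContinuousAt (fun z => h z / h (p i₁)) (p i₁) :=
      (hhU.continuousAt (hUo.mem_nhds hpU)).div_const _
    have hev : ∀ᶠ z in nhds (p i₁), h z / h (p i₁) ∈ Complex.slitPlane ∧ z ∈ U := by
      refine (hca.eventually ?_).and (hUo.mem_nhds hpU)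
      refine Complex.isOpen_slitPlane.mem_nhds ?_
      beta_reduce
      rw [div_self hh0]; exact Complex.one_mem_slitPlane
    obtain ⟨ε, hε, hball⟩ := Metric.eventually_nhds_iff.1 hev
    have hin : ∀ w : ℂ, w.re < Real.log ε → h (p i₁ + Complex.exp w) / h (p i₁) ∈ Complex.slitPlane
        ∧ p i₁ + Complex.exp w ∈ U := by
      intro w hw
      apply hball
      rw [dist_eq_norm, add_sub_cancel_left, Complex.norm_exp, ← Real.lt_log_iff_exp_lt hε]
      exact hw
    have hS : IsPreconnected {w : ℂ | w.re < Real.log ε} :=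
      (convex_halfSpace_re_lt _).isPreconnected
    refine ⟨((Real.log ε - 1 : ℝ) : ℂ), ?_⟩
    have := gc_const (L₁ := L) (L₂ := fun w => n i₁ * w +
        Complex.log (h (p i₁ + Complex.exp w) / h (p i₁)) + Complex.log (h (p i₁))) hS
      (by fun_prop) ?_ ?_ (x := ((Real.log ε - 1 : ℝ) : ℂ) + 2 * Real.pi * Complex.I)
      (y := ((Real.log ε - 1 : ℝ) : ℂ)) (by simp) (by simp)
    · simp only [per] at this
      linear_combination this
    · refine ContinuousOn.add (ContinuousOn.add (by fun_prop) ?_) (by fun_prop)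
      refine ContinuousOn.clog ?_ (fun w hw => (hin w hw).1)
      refine ContinuousOn.div_const ?_ _
      exact hhU.comp (by fun_prop) (fun w hw => (hin w hw).2)
    · intro w hw
      have hhw : h (p i₁ + Complex.exp w) / h (p i₁) ≠ 0 :=
        Complex.slitPlane_ne_zero (hin w hw).1
      rw [hL, Complex.exp_add, Complex.exp_add, Complex.exp_log hh0, Complex.exp_log hhw,
        mul_assoc, div_mul_cancel₀ _ hh0]
      simp only [hψ]
      rw [if_pos (hin w hw).2]
      simp only [hφ, hh]
      rw [← Finset.mul_prod_erase _ _ (Finset.mem_univ i₁), add_sub_cancel_left,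
        ← Complex.exp_int_mul]
  obtain ⟨w, hw⟩ := far
  obtain ⟨w', hw'⟩ := near
  rw [mono w' w, hw] at hw'
  have h2 : (2 * Real.pi * Complex.I : ℂ) ≠ 0 := Complex.two_pi_I_ne_zero
  have := (mul_eq_zero.1 hw'.symm).resolve_right h2
  exact_mod_cast this

/-- A set which is closed and a retract-like continuous image of the line. -/
def GcArc (α : Set ℂ) : Prop :=
  IsCompact α ∧ ∃ (s : ℝ → ℂ) (r : ℂ → ℝ), Continuous s ∧ (∀ t, s t ∈ α) ∧
    ContinuousOn r α ∧ ∀ z ∈ α, s (r z) = z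

theorem GcArc.log {α : Set ℂ} (hα : GcArc α) {p : ℂ} (hp : p ∉ α) :
    ∃ g : ℂ → ℂ, ContinuousOn g α ∧ ∀ z ∈ α, Complex.exp (g z) = z - p := by
  obtain ⟨_, s, r, hs, hsα, hr, hsr⟩ := hα
  obtain ⟨L, hLc, hL⟩ := gc_log_exists (fun t : ℝ => s t - p) (by fun_prop) (by
    intro t
    rw [sub_ne_zero]
    rintro rfl
    exact hp (hsα t))
  refine ⟨fun z => L (r z), hLc.comp_continuousOn hr, fun z hz => ?_⟩
  rw [hL, hsr z hz]

theorem gc_bdd_comp_bound {ι : Type} [Fintype ι] (α : ι → Set ℂ) (hα : ∀ i, GcArc (α i))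
    (Q : Finset ℂ) (hQ : ∀ i j, i ≠ j → α i ∩ α j ⊆ Q) {J : Type} [Fintype J] [DecidableEq J]
    (p : J → ℂ) (hp : ∀ j, p j ∉ ⋃ i, α i)
    (hb : ∀ j, Bornology.IsBounded (connectedComponentIn (⋃ i, α i)ᶜ (p j)))
    (hne : ∀ i j, i ≠ j → p i ∉ connectedComponentIn (⋃ i, α i)ᶜ (p j)) :
    Fintype.card J ≤ Fintype.card ι * (Fintype.card ι * Q.card) := by
  classical
  set K := ⋃ i, α i with hKdef
  have hcl : ∀ i, IsClosed (α i) := fun i => (hα i).1.isClosed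
  have hK : IsClosed K := isClosed_iUnion_of_finite hcl
  have hp' : ∀ j i, p j ∉ α i := fun j i h => hp j (Set.mem_iUnion.2 ⟨i, h⟩)
  choose g hgc hg using fun (j : J) (i : ι) => (hα i).log (hp' j i)
  have hint : ∀ (j : J) (x : ι × ι × Q), ∃ k : ℤ,
      ((x.2.2 : ℂ) ∈ α x.1 → (x.2.2 : ℂ) ∈ α x.2.1 →
        g j x.1 x.2.2 = g j x.2.1 x.2.2 + k * (2 * Real.pi * Complex.I)) := by
    rintro j ⟨s, t, q⟩
    by_cases h : (q : ℂ) ∈ α s ∧ (q : ℂ) ∈ α t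
    · obtain ⟨k, hk⟩ := Complex.exp_eq_exp_iff_exists_int.1
        ((hg j s q h.1).trans (hg j t q h.2).symm)
      exact ⟨k, fun _ _ => hk⟩
    · exact ⟨0, fun h1 h2 => absurd ⟨h1, h2⟩ h⟩
  choose v hv using hint
  by_contra hlt
  have hdep : ¬ LinearIndependent ℤ v := by
    intro hli
    have := hli.fintype_card_le_finrank
    rw [Module.finrank_fintype_fun_eq_card] at this
    apply hlt
    simpa using this
  obtain ⟨n, hn, i₁, hi₁⟩ := Fintype.not_linearIndependent_iff.1 hdep
  apply hi₁
  -- glue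
  have hex : ∀ z : ℂ, ∃ s : Option ι, z ∈ K → ∃ s', s = some s' ∧ z ∈ α s' := by
    intro z
    by_cases hz : z ∈ K
    · obtain ⟨s, hs⟩ := Set.mem_iUnion.1 hz
      exact ⟨some s, fun _ => ⟨s, rfl, hs⟩⟩
    · exact ⟨none, fun h => absurd h hz⟩
  choose σ hσ using hex
  set G : ℂ → ℂ := fun z => (σ z).elim 0 (fun s => ∑ j, n j * g j s z) with hG
  have hGs : ∀ s, ∀ z ∈ α s, G z = ∑ j, n j * g j s z := by
    intro s z hz
    obtain ⟨t, ht, hzt⟩ := hσ z (Set.mem_iUnion.2 ⟨s, hz⟩)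
    simp only [hG, ht, Option.elim]
    by_cases hst : t = s
    · rw [hst]
    have hzQ : z ∈ Q := hQ t s hst ⟨hzt, hz⟩
    have h1 : ∑ j, n j * v j (t, s, ⟨z, hzQ⟩) = 0 := by
      have := congrFun hn (t, s, ⟨z, hzQ⟩)
      simpa using this
    have h2 : ∑ j, (n j : ℂ) * v j (t, s, ⟨z, hzQ⟩) = 0 := by exact_mod_cast h1
    have h3 : ∀ j, (n j : ℂ) * g j t z = n j * g j s z +
        ((n j : ℂ) * v j (t, s, ⟨z, hzQ⟩)) * (2 * Real.pi * Complex.I) := by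
      intro j
      have := hv j (t, s, ⟨z, hzQ⟩) hzt hz
      simp only at this
      rw [this]; ring
    rw [Finset.sum_congr rfl fun j _ => h3 j, Finset.sum_add_distrib, ← Finset.sum_mul, h2]
    ring
  have hGc : ContinuousOn G K := by
    refine (locallyFinite_of_finite α).continuousOn_iUnion hcl fun s => ?_
    have : ContinuousOn (fun z => ∑ j, n j * g j s z) (α s) :=
      continuousOn_finsetSum _ fun j _ => continuousOn_const.mul (hgc j s)
    exact this.congr (hGs s)
  have hGe : ∀ z ∈ K, Complex.exp (G z) = ∏ j, (z - p j) ^ n j := by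
    intro z hz
    obtain ⟨s, hs⟩ := Set.mem_iUnion.1 hz
    rw [hGs s z hs, Complex.exp_sum]
    refine Finset.prod_congr rfl fun j _ => ?_
    rw [Complex.exp_int_mul, hg j s z hs]
  obtain ⟨g', hg'⟩ := ContinuousMap.exists_restrict_eq hK
    (⟨K.domRestrict G, hGc.domRestrict⟩ : C(K, ℂ))
  refine gc_eilenberg hK p n hp i₁ (hb i₁) (fun i hi => hne i i₁ hi) g' g'.continuous ?_
  intro z hz
  have : g' z = G z := congrArg (fun f : C(K, ℂ) => f ⟨z, hz⟩) hg'
  rw [this, hGe z hz]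

theorem gc_unbdd_unique {K : Set ℂ} (hK : Bornology.IsBounded K) {p q : ℂ}
    (hp : ¬ Bornology.IsBounded (connectedComponentIn Kᶜ p))
    (hq : ¬ Bornology.IsBounded (connectedComponentIn Kᶜ q)) :
    connectedComponentIn Kᶜ p = connectedComponentIn Kᶜ q := by
  obtain ⟨R, hR0, hR⟩ := hK.subset_ball_lt 0 0
  set S : Set ℂ := Complex.exp '' {w : ℂ | Real.log R < w.re} with hS
  have hSc : IsPreconnected S :=
    (convex_halfSpace_re_gt _).isPreconnected.image _ (by fun_prop)
  have hSK : S ⊆ Kᶜ := by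
    rintro _ ⟨w, hw, rfl⟩ hK'
    have := hR hK'
    rw [mem_ball_zero_iff, Complex.norm_exp, ← Real.lt_log_iff_exp_lt hR0] at this
    exact absurd hw (not_lt.2 this.le)
  have hmem : ∀ p, ¬ Bornology.IsBounded (connectedComponentIn Kᶜ p) →
      ∃ z ∈ S, z ∈ connectedComponentIn Kᶜ p := by
    intro p hp
    by_contra hcon
    push Not at hcon
    apply hp
    refine (Metric.isBounded_closedBall (x := (0:ℂ)) (r := R)).subset fun z hz => ?_
    by_contra hz2
    rw [mem_closedBall_zero_iff, not_le] at hz2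
    have hz0 : z ≠ 0 := by rintro rfl; simp at hz2; linarith
    refine hcon z ⟨Complex.log z, ?_, Complex.exp_log hz0⟩ hz
    simp only [Set.mem_ofPred_eq, Complex.log_re]
    exact Real.log_lt_log hR0 hz2
  obtain ⟨a, haS, ha⟩ := hmem p hp
  obtain ⟨b, hbS, hb⟩ := hmem q hq
  rw [connectedComponentIn_eq ha, connectedComponentIn_eq hb]
  exact connectedComponentIn_eq (hSc.subset_connectedComponentIn haS hSK hbS)

theorem gc_comp_bound {ι : Type} [Fintype ι] (α : ι → Set ℂ) (hα : ∀ i, GcArc (α i))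
    (Q : Finset ℂ) (hQ : ∀ i j, i ≠ j → α i ∩ α j ⊆ Q) (S : Finset (Set ℂ))
    (hS : ∀ D ∈ S, ∃ p ∈ (⋃ i, α i)ᶜ, D = connectedComponentIn (⋃ i, α i)ᶜ p) :
    S.card ≤ Fintype.card ι * (Fintype.card ι * Q.card) + 1 := by
  classical
  have hKb : Bornology.IsBounded (⋃ i, α i) := (isCompact_iUnion fun i => (hα i).1).isBounded
  rw [← Finset.card_filter_add_card_filter_not (fun D : Set ℂ => Bornology.IsBounded D)]
  refine Nat.add_le_add ?_ ?_
  · set S' := S.filter (fun D : Set ℂ => Bornology.IsBounded D) with hS'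
    have hS2 : ∀ D : S', ∃ p ∈ (⋃ i, α i)ᶜ, (D : Set ℂ) = connectedComponentIn (⋃ i, α i)ᶜ p :=
      fun D => hS D (Finset.mem_filter.1 D.2).1
    choose p hp hpD using hS2
    rw [← Fintype.card_coe]
    refine gc_bdd_comp_bound α hα Q hQ p hp ?_ ?_
    · intro D
      rw [← hpD]
      exact (Finset.mem_filter.1 D.2).2
    · intro D E hDE hmem
      apply hDE
      have := connectedComponentIn_eq hmem
      rw [← hpD, ← hpD] at this
      exact Subtype.ext this.symm
  · rw [Finset.card_le_one]
    intro D hD E hE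
    rw [Finset.mem_filter] at hD hE
    obtain ⟨p, _, rfl⟩ := hS D hD.1
    obtain ⟨q, _, rfl⟩ := hS E hE.1
    exact gc_unbdd_unique hKb hD.2 hE.2

theorem gc_half_arc {γ : Set ℂ} (h : γ ≃ₜ Metric.sphere (0 : Plane) 1) (ε : ℝ) (hε : ε ^ 2 = 1) :
    GcArc {z | ∃ hz : z ∈ γ, 0 ≤ ε * (h ⟨z, hz⟩ : Plane) 1} ∧
    ∃ a b : ℂ, ∀ z, (∃ hz : z ∈ γ, 0 ≤ ε * (h ⟨z, hz⟩ : Plane) 1) →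
      (∃ hz : z ∈ γ, (h ⟨z, hz⟩ : Plane) 1 = 0) → z = a ∨ z = b := by
  classical
  have hsph : ∀ v : Metric.sphere (0 : Plane) 1, (v : Plane) 0 ^ 2 + (v : Plane) 1 ^ 2 = 1 := by
    intro v
    have h1 : ‖(v : Plane)‖ = 1 := by simpa using v.2
    have := EuclideanSpace.norm_sq_eq (v : Plane)
    rw [h1] at this
    simp [Fin.sum_univ_two] at this
    linarith
  set c : ℝ → ℝ := fun t => max (-1) (min 1 t) with hc
  have hc1 : ∀ t, c t ^ 2 ≤ 1 := by
    intro t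
    have h1 : -1 ≤ c t := le_max_left _ _
    have h2 : c t ≤ 1 := max_le (by norm_num) (min_le_left _ _)
    nlinarith
  have hcc : Continuous c := by fun_prop
  set pt : ℝ → Plane := fun t => !₂[c t, ε * Real.sqrt (1 - c t ^ 2)] with hpt
  have hptc : Continuous pt := by
    refine (PiLp.continuous_toLp 2 _).comp ?_
    refine continuous_pi fun i => ?_
    fin_cases i
    · exact hcc
    · simp only [Fin.mk_one, Matrix.cons_val_one, Matrix.cons_val_fin_one]
      fun_prop
  have hptm : ∀ t, pt t ∈ Metric.sphere (0 : Plane) 1 := by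
    intro t
    rw [mem_sphere_zero_iff_norm]
    have h2 : ‖pt t‖ ^ 2 = 1 := by
      rw [EuclideanSpace.norm_sq_eq]
      simp only [Fin.sum_univ_two, Real.norm_eq_abs, sq_abs, hpt]
      simp only [Matrix.cons_val_zero, Matrix.cons_val_one, Matrix.cons_val_fin_one]
      rw [mul_pow, Real.sq_sqrt (by linarith [hc1 t]), hε]; ring
    have h3 := norm_nonneg (pt t)
    nlinarith
  set s : ℝ → ℂ := fun t => (h.symm ⟨pt t, hptm t⟩ : ℂ) with hs
  set r : ℂ → ℝ := fun z => if hz : z ∈ γ then (h ⟨z, hz⟩ : Plane) 0 else 0 with hr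
  have hsc : Continuous s :=
    continuous_subtype_val.comp (h.symm.continuous.comp (hptc.subtype_mk _))
  have hrc : ContinuousOn r γ := by
    rw [continuousOn_iff_continuous_domRestrict]
    have : γ.domRestrict r = fun z : γ => (h z : Plane) 0 := by
      ext z
      simp [hr, z.2]
    rw [this]
    have h0 : Continuous fun v : Plane => v 0 := by fun_prop
    exact h0.comp (continuous_subtype_val.comp h.continuous)
  set α : Set ℂ := {z | ∃ hz : z ∈ γ, 0 ≤ ε * (h ⟨z, hz⟩ : Plane) 1} with hα
  have hsα : ∀ t, s t ∈ α := by
    intro t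
    refine ⟨(h.symm ⟨pt t, hptm t⟩).2, ?_⟩
    simp only [hs, Subtype.coe_eta, Homeomorph.apply_symm_apply, hpt]
    simp only [Matrix.cons_val_one, Matrix.cons_val_fin_one]
    rw [← mul_assoc, ← sq, hε, one_mul]
    exact Real.sqrt_nonneg _
  have hrb : ∀ z ∈ α, r z ∈ Set.Icc (-1 : ℝ) 1 := by
    rintro z ⟨hz, _⟩
    have := hsph (h ⟨z, hz⟩)
    simp only [hr, dif_pos hz]
    constructor <;> nlinarith [sq_nonneg ((h ⟨z, hz⟩ : Plane) 1)]
  have hsr : ∀ z ∈ α, s (r z) = z := by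
    intro z hz'
    have hb := hrb z hz'
    obtain ⟨hz, hz1⟩ := hz'
    have hcr : c (r z) = r z := by
      simp only [hc]
      rw [min_eq_right hb.2, max_eq_right hb.1]
    have : (⟨pt (r z), hptm (r z)⟩ : Metric.sphere (0 : Plane) 1) = h ⟨z, hz⟩ := by
      apply Subtype.ext
      have hv := hsph (h ⟨z, hz⟩)
      have hrz : r z = (h ⟨z, hz⟩ : Plane) 0 := by simp only [hr, dif_pos hz]
      ext i
      fin_cases i
      · simp only [hpt, hcr]
        simpa using hrz
      · simp only [hpt, hcr]
        simp only [Fin.mk_one, Matrix.cons_val_one, Matrix.cons_val_fin_one]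
        rw [hrz]
        have h4 : 1 - (h ⟨z, hz⟩ : Plane) 0 ^ 2 = (ε * (h ⟨z, hz⟩ : Plane) 1) ^ 2 := by
          rw [mul_pow, hε]; linarith
        rw [h4, Real.sqrt_sq hz1, ← mul_assoc, ← sq, hε, one_mul]
    simp only [hs, this, Homeomorph.symm_apply_apply]
  refine ⟨⟨?_, s, r, hsc, hsα, hrc.mono fun z hz => hz.1, hsr⟩, s 1, s (-1), ?_⟩
  · have : α = s '' Set.Icc (-1 : ℝ) 1 := by
      apply Set.Subset.antisymm
      · intro z hz
        exact ⟨r z, hrb z hz, hsr z hz⟩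
      · rintro _ ⟨t, _, rfl⟩
        exact hsα t
    rw [this]
    exact isCompact_Icc.image hsc
  · intro z hz hz0
    have hzz := hsr z hz
    obtain ⟨hz1, h0⟩ := hz0
    have hv := hsph (h ⟨z, hz1⟩)
    rw [h0] at hv
    have hrz : r z = (h ⟨z, hz1⟩ : Plane) 0 := by simp only [hr, dif_pos hz1]
    have : r z = 1 ∨ r z = -1 := by
      have h6 : (r z - 1) * (r z + 1) = 0 := by rw [hrz]; linarith
      rcases mul_eq_zero.1 h6 with h7 | h7
      · left; linarith
      · right; linarith
    rcases this with h5 | h5 <;> rw [h5] at hzz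
    · exact Or.inl hzz.symm
    · exact Or.inr hzz.symm

theorem gc_jordan_arcs {γ : Set ℂ} (h : γ ≃ₜ Metric.sphere (0 : Plane) 1) :
    ∃ (α : Bool → Set ℂ) (a b : ℂ), (∀ i, GcArc (α i)) ∧ (⋃ i, α i) = γ ∧
      ∀ i j, i ≠ j → α i ∩ α j ⊆ {a, b} := by
  obtain ⟨h1, a, b, hab⟩ := gc_half_arc h 1 (by norm_num)
  obtain ⟨h2, -⟩ := gc_half_arc h (-1) (by norm_num)
  have key : ∀ z, (∃ hz : z ∈ γ, 0 ≤ 1 * (h ⟨z, hz⟩ : Plane) 1) →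
      (∃ hz : z ∈ γ, 0 ≤ -1 * (h ⟨z, hz⟩ : Plane) 1) → z = a ∨ z = b := by
    intro z hz1 hz2
    refine hab z hz1 ?_
    obtain ⟨hz, h1⟩ := hz1
    obtain ⟨_, h2⟩ := hz2
    exact ⟨hz, by linarith⟩
  refine ⟨fun i => if i then {z | ∃ hz : z ∈ γ, 0 ≤ 1 * (h ⟨z, hz⟩ : Plane) 1}
    else {z | ∃ hz : z ∈ γ, 0 ≤ -1 * (h ⟨z, hz⟩ : Plane) 1}, a, b, ?_, ?_, ?_⟩
  · intro i; cases i
    · simpa using h2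
    · simpa using h1
  · ext z
    rw [Set.mem_iUnion]
    constructor
    · rintro ⟨i, hi⟩
      cases i
      · exact hi.1
      · exact hi.1
    · intro hz
      rcases le_total 0 ((h ⟨z, hz⟩ : Plane) 1) with h0 | h0
      · exact ⟨true, hz, by linarith⟩
      · exact ⟨false, hz, by linarith⟩
  · intro i j hij z hz
    cases i <;> cases j
    · exact absurd rfl hij
    · exact key z hz.2 hz.1
    · exact key z hz.1 hz.2
    · exact absurd rfl hij

theorem gc_two_curves_complex {γ₁ γ₂ : Set ℂ} (h₁ : γ₁ ≃ₜ Metric.sphere (0 : Plane) 1)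
    (h₂ : γ₂ ≃ₜ Metric.sphere (0 : Plane) 1) (hfin : (γ₁ ∩ γ₂).Finite) {m : ℕ}
    (hm : (γ₁ ∩ γ₂).ncard ≤ m) (S : Finset (Set ℂ))
    (hS : ∀ D ∈ S, ∃ p ∈ (γ₁ ∪ γ₂)ᶜ, D = connectedComponentIn (γ₁ ∪ γ₂)ᶜ p) :
    S.card ≤ 16 * (m + 4) + 1 := by
  classical
  obtain ⟨α, a, b, hα, hαu, hαi⟩ := gc_jordan_arcs h₁
  obtain ⟨β, c, d, hβ, hβu, hβi⟩ := gc_jordan_arcs h₂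
  set δ : Bool ⊕ Bool → Set ℂ := Sum.elim α β with hδ
  have hun : (⋃ i, δ i) = γ₁ ∪ γ₂ := by
    rw [Set.iUnion_sum]
    simp only [hδ, Sum.elim_inl, Sum.elim_inr, hαu, hβu]
  set Q : Finset ℂ := hfin.toFinset ∪ {a, b, c, d} with hQ
  have hαs : ∀ i, α i ⊆ γ₁ := fun i => hαu ▸ Set.subset_iUnion α i
  have hβs : ∀ i, β i ⊆ γ₂ := fun i => hβu ▸ Set.subset_iUnion β i
  have hQc : Q.card ≤ m + 4 := by
    refine (Finset.card_union_le _ _).trans (Nat.add_le_add ?_ Finset.card_le_four)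
    rwa [← Set.ncard_eq_toFinset_card _ hfin]
  have := gc_comp_bound δ (by rintro (i | i); exacts [hα i, hβ i]) Q ?_ S (by rw [hun]; exact hS)
  · simp only [Fintype.card_sum, Fintype.card_bool] at this
    omega
  · rintro (i | i) (j | j) hij z hz
    · have := hαi i j (by rintro rfl; exact hij rfl) hz
      simp only [Set.mem_insert_iff, Set.mem_singleton_iff] at this
      simp only [hQ, Finset.coe_union, Set.mem_union, Finset.mem_coe, Finset.mem_insert,
        Finset.mem_singleton]
      tauto
    · simp only [hQ, Finset.coe_union, Set.mem_union, Finset.mem_coe, Set.Finite.mem_toFinset]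
      exact Or.inl ⟨hαs i hz.1, hβs j hz.2⟩
    · simp only [hQ, Finset.coe_union, Set.mem_union, Finset.mem_coe, Set.Finite.mem_toFinset]
      exact Or.inl ⟨hαs j hz.2, hβs i hz.1⟩
    · have := hβi i j (by rintro rfl; exact hij rfl) hz
      simp only [Set.mem_insert_iff, Set.mem_singleton_iff] at this
      simp only [hQ, Finset.coe_union, Set.mem_union, Finset.mem_coe, Finset.mem_insert,
        Finset.mem_singleton]
      tauto

theorem gc_two_curves {γ₁ γ₂ : Set Plane} (h₁ : IsJordanCurve γ₁)
    (h₂ : IsJordanCurve γ₂) (hfin : (γ₁ ∩ γ₂).Finite) {m : ℕ}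
    (hm : (γ₁ ∩ γ₂).ncard ≤ m) (S : Finset (Set Plane))
    (hS : ∀ D ∈ S, ∃ p ∈ (γ₁ ∪ γ₂)ᶜ, D = connectedComponentIn (γ₁ ∪ γ₂)ᶜ p) :
    S.card ≤ 16 * (m + 4) + 1 := by
  classical
  let E : Plane ≃ₜ ℂ := Complex.orthonormalBasisOneI.repr.symm.toHomeomorph
  obtain ⟨e₁⟩ := h₁
  obtain ⟨e₂⟩ := h₂
  have hinj : Function.Injective (fun D : Set Plane => E '' D) := E.injective.image_injective
  have hint : E '' γ₁ ∩ E '' γ₂ = E '' (γ₁ ∩ γ₂) := (Set.image_inter E.injective).symm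
  rw [← Finset.card_image_of_injective S hinj]
  refine gc_two_curves_complex ((E.image γ₁).symm.trans e₁) ((E.image γ₂).symm.trans e₂)
    (hint ▸ hfin.image E) (by rw [hint, Set.ncard_image_of_injective _ E.injective]; exact hm) _ ?_
  intro D hD
  obtain ⟨D', hD', rfl⟩ := Finset.mem_image.1 hD
  obtain ⟨p, hp, rfl⟩ := hS D' hD'
  have hc : (E '' γ₁ ∪ E '' γ₂)ᶜ = E '' (γ₁ ∪ γ₂)ᶜ := by
    rw [← Set.image_union, Set.image_compl_eq E.bijective]
  refine ⟨E p, ?_, ?_⟩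
  · rw [hc]; exact Set.mem_image_of_mem _ hp
  · rw [hc]; exact E.image_connectedComponentIn hp

theorem gc_cut {n : ℕ} (P : Finset (Fin n × Fin n)) (hP : ∀ p ∈ P, p.1 ≠ p.2) :
    ∃ S : Finset (Fin n), P.card ≤ 4 * (P.filter fun p => p.1 ∈ S ∧ p.2 ∉ S).card := by
  classical
  have hcount : ∀ p ∈ P, 4 * (Finset.univ.filter fun S : Finset (Fin n) =>
      p.1 ∈ S ∧ p.2 ∉ S).card = 2 ^ n := by
    intro p hp
    have hne := hP p hp
    have h1 : (Finset.univ.filter fun S : Finset (Fin n) => p.1 ∈ S ∧ p.2 ∉ S)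
        = Finset.Icc {p.1} {p.2}ᶜ := by
      ext S
      simp only [Finset.mem_filter, Finset.mem_univ, true_and, Finset.mem_Icc,
        Finset.singleton_subset_iff]
      refine and_congr_right fun _ => ?_
      constructor
      · intro h v hv
        rw [Finset.mem_compl, Finset.mem_singleton]
        rintro rfl
        exact h hv
      · intro h hv
        simpa using h hv
    rw [h1, Finset.card_Icc_finset (by simpa using hne.symm), Finset.card_compl, Finset.card_singleton,
      Finset.card_singleton, Fintype.card_fin]
    have hn : 2 ≤ n := by
      have h3 := p.1.2
      have h4 := p.2.2
      have h5 : (p.1 : ℕ) ≠ p.2 := fun h => hne (Fin.ext h)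
      omega
    obtain ⟨k, rfl⟩ := Nat.exists_eq_add_of_le hn
    have : 2 + k - 1 - 1 = k := by omega
    rw [this, pow_add]
    norm_num
  have hsum : ∑ S : Finset (Fin n), 4 * (P.filter fun p => p.1 ∈ S ∧ p.2 ∉ S).card
      = ∑ S : Finset (Fin n), P.card := by
    rw [Finset.sum_const, Finset.card_univ, Fintype.card_finset, Fintype.card_fin, smul_eq_mul,
      ← Finset.mul_sum]
    simp only [Finset.card_filter]
    rw [Finset.sum_comm]
    simp only [← Finset.card_filter]
    rw [Finset.mul_sum, Finset.sum_congr rfl hcount, Finset.sum_const, smul_eq_mul, mul_comm]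
  obtain ⟨S, _, hS⟩ := Finset.exists_le_of_sum_le (Finset.univ_nonempty) hsum.ge
  exact ⟨S, hS⟩

theorem gc_comb {n : ℕ} (hn : 0 < n) (adj : Fin n → Fin n → Prop) [DecidableRel adj]
    (hsymm : ∀ a b, adj a b → adj b a) (hirr : ∀ a b, adj a b → a ≠ b) (T : ℕ)
    (hT : T ≤ (Finset.univ.filter fun p : Fin n × Fin n => adj p.1 p.2).card)
    (hT2 : 192 * n ^ 5 ≤ T ^ 3) :
    ∃ (x y : Fin n) (S : Finset (Fin n)), x ≠ y ∧
      T ^ 3 ≤ 256 * n ^ 4 * (Finset.univ.filter fun p : Fin n × Fin n =>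
        (adj p.1 p.2 ∧ adj p.1 x ∧ adj p.2 y ∧ p.1 ≠ y ∧ p.2 ≠ x) ∧ p.1 ∈ S ∧ p.2 ∉ S).card := by
  classical
  set E := Finset.univ.filter fun p : Fin n × Fin n => adj p.1 p.2 with hE
  set D := E.card with hD
  set deg : Fin n → ℕ := fun a => (Finset.univ.filter fun b => adj a b).card with hdeg
  have hDn : D ≤ n * n := by
    refine (Finset.card_le_univ _).trans ?_
    simp
  -- low degree vertices
  have hlow1 : 4 * (E.filter fun p => 4 * n * deg p.1 < D).card ≤ D := by
    have h1 : (E.filter fun p => 4 * n * deg p.1 < D).card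
        ≤ ∑ a : Fin n, if 4 * n * deg a < D then deg a else 0 := by
      rw [Finset.card_eq_sum_card_fiberwise (f := Prod.fst) (t := Finset.univ) (by simp)]
      refine Finset.sum_le_sum fun a _ => ?_
      split_ifs with h
      · refine Finset.card_le_card_of_injOn Prod.snd ?_ ?_
        · rintro ⟨u, v⟩ hp
          simp only [hE, Finset.coe_filter, Finset.mem_filter, Finset.mem_univ, true_and,
            Set.mem_ofPred_eq] at hp ⊢
          rw [← hp.2]; exact hp.1.1
        · rintro ⟨u, v⟩ hp ⟨u', v'⟩ hp' heq
          simp only [Finset.coe_filter, Finset.mem_filter, Set.mem_ofPred_eq] at hp hp' heq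
          rw [Prod.mk.injEq]
          exact ⟨hp.2.trans hp'.2.symm, heq⟩
      · rw [Nat.le_zero, Finset.card_eq_zero, Finset.eq_empty_iff_forall_notMem]
        rintro ⟨u, v⟩ hp
        simp only [Finset.mem_filter] at hp
        rw [hp.2] at hp
        exact h hp.1.2
    have h2 : 4 * n * (∑ a : Fin n, if 4 * n * deg a < D then deg a else 0) ≤ n * D := by
      rw [Finset.mul_sum]
      calc _ ≤ ∑ a : Fin n, D := by
            refine Finset.sum_le_sum fun a _ => ?_
            split_ifs with h
            · exact h.le
            · simp
        _ = n * D := by simp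
    have h3 : n * (4 * (E.filter fun p => 4 * n * deg p.1 < D).card) ≤ n * D := by
      calc _ = 4 * n * (E.filter fun p => 4 * n * deg p.1 < D).card := by ring
        _ ≤ _ := Nat.mul_le_mul_left _ h1
        _ ≤ _ := h2
    exact Nat.le_of_mul_le_mul_left h3 hn
  have hlow2 : (E.filter fun p => 4 * n * deg p.2 < D).card
      = (E.filter fun p => 4 * n * deg p.1 < D).card := by
    refine Finset.card_bij' (fun p _ => p.swap) (fun p _ => p.swap) ?_ ?_ ?_ ?_
    · intro p hp
      simp only [hE, Finset.mem_filter, Finset.mem_univ, true_and] at hp ⊢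
      exact ⟨hsymm _ _ hp.1, hp.2⟩
    · intro p hp
      simp only [hE, Finset.mem_filter, Finset.mem_univ, true_and] at hp ⊢
      exact ⟨hsymm _ _ hp.1, hp.2⟩
    · intro p _; simp
    · intro p _; simp
  set good := E.filter fun p => ¬ (4 * n * deg p.1 < D) ∧ ¬ (4 * n * deg p.2 < D) with hgood
  have hgc : D ≤ 2 * good.card := by
    have h1 : E ⊆ good ∪ ((E.filter fun p => 4 * n * deg p.1 < D) ∪
        (E.filter fun p => 4 * n * deg p.2 < D)) := by
      intro p hp
      simp only [hgood, Finset.mem_union, Finset.mem_filter]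
      tauto
    have h2 := (Finset.card_le_card h1).trans (Finset.card_union_le _ _)
    have h3 := Finset.card_union_le (E.filter fun p => 4 * n * deg p.1 < D)
      (E.filter fun p => 4 * n * deg p.2 < D)
    rw [← hD] at h2
    omega
  set W := ∑ p ∈ E, deg p.1 * deg p.2 with hW
  have hWlow : D ^ 3 ≤ 32 * n ^ 2 * W := by
    have h1 : good.card * (D * D) ≤ 16 * n ^ 2 * W := by
      rw [hW, Finset.mul_sum]
      calc good.card * (D * D) = ∑ p ∈ good, D * D := by simp
        _ ≤ ∑ p ∈ good, 16 * n ^ 2 * (deg p.1 * deg p.2) := by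
            refine Finset.sum_le_sum fun p hp => ?_
            have := (Finset.mem_filter.1 hp).2
            calc D * D ≤ (4 * n * deg p.1) * (4 * n * deg p.2) :=
                  Nat.mul_le_mul (not_lt.1 this.1) (not_lt.1 this.2)
              _ = _ := by ring
        _ ≤ _ := Finset.sum_le_sum_of_subset (Finset.filter_subset _ _)
    calc D ^ 3 = D * (D * D) := by ring
      _ ≤ 2 * good.card * (D * D) := Nat.mul_le_mul_right _ hgc
      _ = 2 * (good.card * (D * D)) := by ring
      _ ≤ 2 * (16 * n ^ 2 * W) := Nat.mul_le_mul_left _ h1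
      _ = _ := by ring
  -- nondegenerate walks
  set R : Fin n × Fin n → Fin n × Fin n → Prop := fun q p =>
    q.1 ≠ q.2 ∧ adj p.1 q.1 ∧ adj p.2 q.2 ∧ p.1 ≠ q.2 ∧ p.2 ≠ q.1 with hR
  have hnd : ∀ p ∈ E, deg p.1 * deg p.2
      ≤ (Finset.univ.filter fun q => R q p).card + 3 * n := by
    intro p _
    have h0 : deg p.1 * deg p.2 = ((Finset.univ.filter fun b => adj p.1 b) ×ˢ
      (Finset.univ.filter fun b => adj p.2 b)).card := by rw [Finset.card_product]
    rw [h0]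
    have h1 : ((Finset.univ.filter fun b => adj p.1 b) ×ˢ
      (Finset.univ.filter fun b => adj p.2 b)) ⊆ (Finset.univ.filter fun q => R q p) ∪
        (Finset.univ.image (fun v : Fin n => (v, v)) ∪
          (Finset.univ.image (fun v : Fin n => (v, p.1)) ∪
            Finset.univ.image (fun v : Fin n => (p.2, v)))) := by
      rintro ⟨x, y⟩ hq
      simp only [Finset.mem_product, Finset.mem_filter, Finset.mem_univ, true_and] at hq
      simp only [hR, Finset.mem_union, Finset.mem_filter, Finset.mem_univ, true_and,
        Finset.mem_image, Prod.mk.injEq]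
      by_cases c1 : x = y
      · right; left; exact ⟨x, rfl, c1⟩
      by_cases c2 : p.1 = y
      · right; right; left; exact ⟨x, rfl, c2⟩
      by_cases c3 : p.2 = x
      · right; right; right; exact ⟨y, c3, rfl⟩
      left
      exact ⟨c1, hq.1, hq.2, c2, c3⟩
    have h2 := Finset.card_le_card h1
    have hi : ∀ f : Fin n → Fin n × Fin n, (Finset.univ.image f).card ≤ n := by
      intro f
      simpa using (Finset.card_image_le (s := Finset.univ) (f := f))
    have i1 := hi (fun v : Fin n => (v, v))
    have i2 := hi (fun v : Fin n => (v, p.1))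
    have i3 := hi (fun v : Fin n => (p.2, v))
    have u1 := Finset.card_union_le (Finset.univ.filter fun q => R q p)
        (Finset.univ.image (fun v : Fin n => (v, v)) ∪
          (Finset.univ.image (fun v : Fin n => (v, p.1)) ∪
            Finset.univ.image (fun v : Fin n => (p.2, v))))
    have u2 := Finset.card_union_le (Finset.univ.image (fun v : Fin n => (v, v)))
          (Finset.univ.image (fun v : Fin n => (v, p.1)) ∪
            Finset.univ.image (fun v : Fin n => (p.2, v)))
    have u3 := Finset.card_union_le (Finset.univ.image (fun v : Fin n => (v, p.1)))
            (Finset.univ.image (fun v : Fin n => (p.2, v)))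
    omega
  set W' := ∑ q : Fin n × Fin n, (E.filter fun p => R q p).card with hW'
  have hWW : W ≤ W' + 3 * n ^ 3 := by
    calc W ≤ ∑ p ∈ E, ((Finset.univ.filter fun q => R q p).card + 3 * n) :=
          Finset.sum_le_sum hnd
      _ = W' + D * (3 * n) := by
          rw [Finset.sum_add_distrib, Finset.sum_const, smul_eq_mul, hW']
          congr 1
          simp only [Finset.card_filter]
          rw [Finset.sum_comm]
      _ ≤ W' + 3 * n ^ 3 := by nlinarith
  have hmain : T ^ 3 ≤ 64 * n ^ 2 * W' := by
    have h1 : T ^ 3 ≤ D ^ 3 := Nat.pow_le_pow_left hT 3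
    have h2 : 32 * n ^ 2 * W ≤ 32 * n ^ 2 * (W' + 3 * n ^ 3) := Nat.mul_le_mul_left _ hWW
    have h3 : 32 * n ^ 2 * (W' + 3 * n ^ 3) = 32 * (n ^ 2 * W') + 96 * n ^ 5 := by ring
    have h4 : 64 * n ^ 2 * W' = 64 * (n ^ 2 * W') := by ring
    omega
  obtain ⟨q, -, hq⟩ : ∃ q ∈ (Finset.univ : Finset (Fin n × Fin n)),
      W' ≤ n ^ 2 * (E.filter fun p => R q p).card := by
    have : Nonempty (Fin n) := ⟨⟨0, hn⟩⟩
    refine Finset.exists_le_of_sum_le Finset.univ_nonempty ?_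
    rw [← Finset.mul_sum, Finset.sum_const, ← hW']
    simp [sq]
  have hTpos : 0 < T ^ 3 := lt_of_lt_of_le (by positivity) hT2
  have hfin : T ^ 3 ≤ 64 * n ^ 4 * (E.filter fun p => R q p).card := by
    calc T ^ 3 ≤ 64 * n ^ 2 * W' := hmain
      _ ≤ 64 * n ^ 2 * (n ^ 2 * (E.filter fun p => R q p).card) := Nat.mul_le_mul_left _ hq
      _ = _ := by ring
  have hpos : 0 < (E.filter fun p => R q p).card := by
    by_contra h
    have : (E.filter fun p => R q p).card = 0 := by omega
    rw [this] at hfin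
    omega
  obtain ⟨p0, hp0⟩ := Finset.card_pos.1 hpos
  have hxy : q.1 ≠ q.2 := (Finset.mem_filter.1 hp0).2.1
  obtain ⟨S, hS⟩ := gc_cut (E.filter fun p => R q p) (by
    intro p hp
    have := (Finset.mem_filter.1 hp).1
    simp only [hE, Finset.mem_filter] at this
    exact hirr _ _ this.2)
  refine ⟨q.1, q.2, S, hxy, ?_⟩
  calc T ^ 3 ≤ 64 * n ^ 4 * (E.filter fun p => R q p).card := hfin
    _ ≤ 64 * n ^ 4 * (4 * ((E.filter fun p => R q p).filter
          fun p => p.1 ∈ S ∧ p.2 ∉ S).card) := Nat.mul_le_mul_left _ hS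
    _ = 256 * n ^ 4 * ((E.filter fun p => R q p).filter
          fun p => p.1 ∈ S ∧ p.2 ∉ S).card := by ring
    _ ≤ _ := by
      refine Nat.mul_le_mul_left _ (Finset.card_le_card ?_)
      intro p hp
      simp only [hE, hR, Finset.mem_filter, Finset.mem_univ, true_and] at hp ⊢
      tauto

theorem gc_numeric (C : ℝ) (hC : 0 < C) (m n T : ℕ) (hn0 : ⌈(192 / C ^ 3) ^ 2⌉₊ + 2 ≤ n)
    (hT : C * (n : ℝ) ^ ((2 : ℝ) - 1 / (3 * m + 15)) ≤ (T : ℝ)) : 192 * n ^ 5 ≤ T ^ 3 := by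
  have hn1 : (1 : ℝ) ≤ n := by exact_mod_cast (by omega : 1 ≤ n)
  have hn' : (192 / C ^ 3) ^ 2 ≤ (n : ℝ) := by
    refine (Nat.le_ceil _).trans ?_
    exact_mod_cast (by omega : ⌈(192 / C ^ 3) ^ 2⌉₊ ≤ n)
  have hm : (15 : ℝ) ≤ 3 * m + 15 := by
    have : (0 : ℝ) ≤ m := Nat.cast_nonneg m
    linarith
  have hδ : 1 / (3 * (m : ℝ) + 15) ≤ 1 / 6 :=
    one_div_le_one_div_of_le (by norm_num) (by linarith)
  have h1 : C * (n : ℝ) ^ ((11 : ℝ) / 6) ≤ T := by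
    refine le_trans ?_ hT
    refine mul_le_mul_of_nonneg_left ?_ hC.le
    exact Real.rpow_le_rpow_of_exponent_le hn1 (by linarith)
  have h2 : C ^ 3 * ((n : ℝ) ^ 5 * Real.sqrt n) ≤ (T : ℝ) ^ 3 := by
    have := pow_le_pow_left₀ (by positivity) h1 3
    rw [mul_pow, ← Real.rpow_natCast ((n : ℝ) ^ ((11 : ℝ) / 6)) 3,
      ← Real.rpow_mul (by positivity)] at this
    have h3 : ((11 : ℝ) / 6 * ((3 : ℕ) : ℝ)) = (5 : ℕ) + 1 / 2 := by norm_num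
    rw [h3, Real.rpow_add (by linarith), Real.rpow_natCast, ← Real.sqrt_eq_rpow] at this
    exact this
  have h3 : 192 / C ^ 3 ≤ Real.sqrt n := Real.le_sqrt_of_sq_le hn'
  have h4 : 192 ≤ C ^ 3 * Real.sqrt n := by
    rw [div_le_iff₀ (by positivity)] at h3
    linarith
  have h5 : (192 : ℝ) * (n : ℝ) ^ 5 ≤ (T : ℝ) ^ 3 := by
    calc (192 : ℝ) * (n : ℝ) ^ 5 ≤ (C ^ 3 * Real.sqrt n) * (n : ℝ) ^ 5 :=
          mul_le_mul_of_nonneg_right h4 (by positivity)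
      _ = C ^ 3 * ((n : ℝ) ^ 5 * Real.sqrt n) := by ring
      _ ≤ _ := h2
  exact_mod_cast h5

theorem gc_numeric2 (C : ℝ) (hC : 0 < C) (m n T N X : ℕ) (hn : 0 < n) (hN : 0 < N)
    (hT : C * (n : ℝ) ^ ((2 : ℝ) - 1 / (3 * m + 15)) ≤ (T : ℝ))
    (hX : T ^ 3 ≤ 256 * n ^ 4 * (N * X)) :
    C ^ 2 / (256 * N) * (T : ℝ) / (n : ℝ) ^ ((2 : ℝ) / (3 * m + 15)) ≤ (X : ℝ) := by
  have hn' : (0 : ℝ) < n := by exact_mod_cast hn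
  have hN' : (0 : ℝ) < N := by exact_mod_cast hN
  have hX' : (T : ℝ) ^ 3 ≤ 256 * (n : ℝ) ^ 4 * (N * X) := by exact_mod_cast hX
  set z := (n : ℝ) ^ ((2 : ℝ) / (3 * m + 15)) with hz
  have hzpos : 0 < z := by positivity
  have h2 : C ^ 2 * ((n : ℝ) ^ 4 / z) ≤ (T : ℝ) ^ 2 := by
    have := pow_le_pow_left₀ (by positivity) hT 2
    rw [mul_pow, ← Real.rpow_natCast ((n : ℝ) ^ ((2 : ℝ) - 1 / (3 * m + 15))) 2,
      ← Real.rpow_mul (by positivity)] at this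
    have h3 : (((2 : ℝ) - 1 / (3 * m + 15)) * ((2 : ℕ) : ℝ)) = (4 : ℕ) - 2 / (3 * m + 15) := by
      push_cast; ring
    rw [h3, Real.rpow_sub hn', Real.rpow_natCast] at this
    exact this
  have h4 : C ^ 2 * ((n : ℝ) ^ 4 / z) * T ≤ 256 * (n : ℝ) ^ 4 * (N * X) := by
    calc _ ≤ (T : ℝ) ^ 2 * T := mul_le_mul_of_nonneg_right h2 (by positivity)
      _ = (T : ℝ) ^ 3 := by ring
      _ ≤ _ := hX'
  have h5 : C ^ 2 / (256 * N) * (T : ℝ) / z =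
      (C ^ 2 * ((n : ℝ) ^ 4 / z) * T) / (256 * (n : ℝ) ^ 4 * N) := by
    field_simp
  rw [h5, div_le_iff₀ (by positivity)]
  linarith

/-- Lemma (ground curves): if an `m`-intersecting family in general position has many
touching points, then there are two curves `γ i₁, γ i₂`, a connected component `Δ` of the
complement of their union, and disjoint subfamilies `A` (touching `γ i₁`) and `B`
(touching `γ i₂`), such that many touching points lie in `Δ` and come from an `A`–`B`
pair. -/
theorem ground_curves_lemma (C : ℝ) (hC : 0 < C) (m : ℕ) (hm : 1 ≤ m) :
    ∃ (n₀ : ℕ) (c : ℝ), 2 ≤ n₀ ∧ 0 < c ∧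
      ∀ (n : ℕ) (γ : Fin n → Set Plane),
        n₀ ≤ n →
        Function.Injective γ →
        (∀ i, IsJordanCurve (γ i)) →
        GenPos γ →
        MIntersecting m γ →
        C * (n : ℝ) ^ ((2 : ℝ) - 1 / (3 * m + 15)) ≤ ((touchPoints γ).ncard : ℝ) →
        ∃ (i₁ i₂ : Fin n) (Δ : Set Plane) (A B : Set (Fin n)),
          i₁ ≠ i₂ ∧
          (∃ p ∈ (γ i₁ ∪ γ i₂)ᶜ, Δ = connectedComponentIn ((γ i₁ ∪ γ i₂)ᶜ) p) ∧
          Disjoint A B ∧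
          i₁ ∉ A ∪ B ∧ i₂ ∉ A ∪ B ∧
          (∀ a ∈ A, Touches (γ a) (γ i₁)) ∧
          (∀ b ∈ B, Touches (γ b) (γ i₂)) ∧
          c * ((touchPoints γ).ncard : ℝ) / (n : ℝ) ^ ((2 : ℝ) / (3 * m + 15)) ≤
            (({x ∈ Δ | ∃ a ∈ A, ∃ b ∈ B, γ a ∩ γ b = {x}}).ncard : ℝ) := by
  classical
  set N : ℕ := 16 * (m + 4) + 1 with hN
  have hNpos : 0 < N := by omega
  refine ⟨⌈(192 / C ^ 3) ^ 2⌉₊ + 2, C ^ 2 / (256 * N), by omega, by positivity, ?_⟩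
  intro n γ hn _ hJ hG hM hT
  have hT2 := gc_numeric C hC m n _ hn hT
  have hnpos : 0 < n := by omega
  let adj : Fin n → Fin n → Prop := fun a b => a ≠ b ∧ Touches (γ a) (γ b)
  have hpt : ∀ p : Fin n × Fin n, ∃ x : Plane, Touches (γ p.1) (γ p.2) → γ p.1 ∩ γ p.2 = {x} := by
    intro p
    by_cases h : Touches (γ p.1) (γ p.2)
    · obtain ⟨x, hx⟩ := h
      exact ⟨x, fun _ => hx⟩
    · exact ⟨0, fun h' => absurd h' h⟩
  choose pt hpt using hpt
  have hTsub : touchPoints γ ⊆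
      ((Finset.univ.filter fun p : Fin n × Fin n => adj p.1 p.2).image pt : Finset Plane) := by
    rintro x ⟨i, j, hij, hx⟩
    rw [Finset.mem_coe, Finset.mem_image]
    refine ⟨(i, j), ?_, ?_⟩
    · rw [Finset.mem_filter]
      exact ⟨Finset.mem_univ _, hij, x, hx⟩
    · have := hpt (i, j) ⟨x, hx⟩
      simp only [hx] at this
      exact (Set.singleton_injective this).symm
  have hTfin : (touchPoints γ).Finite := (Finset.finite_toSet _).subset hTsub
  have hTcard : (touchPoints γ).ncard ≤
      (Finset.univ.filter fun p : Fin n × Fin n => adj p.1 p.2).card := by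
    refine (Set.ncard_le_ncard hTsub (Finset.finite_toSet _)).trans ?_
    rw [Set.ncard_coe_finset]
    exact Finset.card_image_le
  obtain ⟨x, y, S, hxy, hbound⟩ := gc_comb hnpos adj
    (fun a b h => ⟨h.1.symm, by obtain ⟨u, hu⟩ := h.2; exact ⟨u, by rw [Set.inter_comm]; exact hu⟩⟩)
    (fun a b h => h.1) _ hTcard hT2
  set P := Finset.univ.filter fun p : Fin n × Fin n =>
        (adj p.1 p.2 ∧ adj p.1 x ∧ adj p.2 y ∧ p.1 ≠ y ∧ p.2 ≠ x) ∧ p.1 ∈ S ∧ p.2 ∉ S with hP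
  have hPm : ∀ p ∈ P, (adj p.1 p.2 ∧ adj p.1 x ∧ adj p.2 y ∧ p.1 ≠ y ∧ p.2 ≠ x) ∧
      p.1 ∈ S ∧ p.2 ∉ S := fun p hp => (Finset.mem_filter.1 hp).2
  have hmem : ∀ p ∈ P, pt p ∈ γ p.1 ∧ pt p ∈ γ p.2 := by
    intro p hp
    have h1 := hpt p (hPm p hp).1.1.2
    have h2 : pt p ∈ γ p.1 ∩ γ p.2 := by rw [h1]; rfl
    exact h2
  have hPpos : 0 < P.card := by
    by_contra h
    have h0 : P.card = 0 := by omega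
    rw [h0] at hbound
    have : 0 < 192 * n ^ 5 := by positivity
    omega
  have hinj : Set.InjOn pt P := by
    intro p hp q hq hpq
    obtain ⟨a1, a2⟩ := hmem p hp
    obtain ⟨b1, b2⟩ := hmem q hq
    rw [← hpq] at b1 b2
    obtain ⟨⟨⟨np, _⟩, _⟩, pS, pS'⟩ := hPm p hp
    obtain ⟨⟨⟨nq, _⟩, _⟩, qS, qS'⟩ := hPm q hq
    have e1 : p.1 = q.1 := by
      rcases hG.2 _ _ _ _ a1 a2 b1 with h | h | h
      · exact absurd h np
      · exact h
      · exact absurd (h ▸ qS) pS'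
    have e2 : p.2 = q.2 := by
      rcases hG.2 _ _ _ _ a1 a2 b2 with h | h | h
      · exact absurd h np
      · exact absurd (h ▸ pS) qS'
      · exact h
    exact Prod.ext e1 e2
  set pts := P.image pt with hpts
  have hptsc : pts.card = P.card := Finset.card_image_of_injOn hinj
  have hoff : ∀ z ∈ pts, z ∈ (γ x ∪ γ y)ᶜ := by
    intro z hz
    obtain ⟨p, hp, rfl⟩ := Finset.mem_image.1 hz
    obtain ⟨a1, a2⟩ := hmem p hp
    obtain ⟨⟨⟨np, _⟩, ⟨h1, _⟩, ⟨h2, _⟩, h3, h4⟩, _⟩ := hPm p hp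
    rintro (h | h)
    · rcases hG.2 _ _ _ _ a1 a2 h with h | h | h
      · exact np h
      · exact h1 h
      · exact h4 h
    · rcases hG.2 _ _ _ _ a1 a2 h with h | h | h
      · exact np h
      · exact h3 h
      · exact h2 h
  set cmp : Plane → Set Plane := fun z => connectedComponentIn ((γ x ∪ γ y)ᶜ) z with hcmp
  have him : (pts.image cmp).card ≤ N := by
    refine gc_two_curves (hJ x) (hJ y) (hG.1 x y hxy) (hM x y hxy) _ ?_
    intro D hD
    obtain ⟨z, hz, rfl⟩ := Finset.mem_image.1 hD
    exact ⟨z, hoff z hz, rfl⟩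
  have hne : (pts.image cmp).Nonempty := by
    rw [Finset.image_nonempty, ← Finset.card_pos, hptsc]
    exact hPpos
  obtain ⟨Δ, hΔ, hΔc⟩ : ∃ Δ ∈ pts.image cmp,
      pts.card ≤ N * (pts.filter fun z => cmp z = Δ).card := by
    refine Finset.exists_le_of_sum_le hne ?_
    rw [Finset.sum_const, smul_eq_mul, ← Finset.mul_sum, ← Finset.card_eq_sum_card_image]
    exact Nat.mul_le_mul_right _ him
  obtain ⟨z0, hz0, hz0Δ⟩ := Finset.mem_image.1 hΔ
  refine ⟨x, y, Δ, {a | a ∈ S ∧ adj a x ∧ a ≠ y}, {b | b ∉ S ∧ adj b y ∧ b ≠ x}, hxy,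
    ⟨z0, hoff z0 hz0, hz0Δ.symm⟩, ?_, ?_, ?_, ?_, ?_, ?_⟩
  · rw [Set.disjoint_left]
    intro a ha hb
    exact hb.1 ha.1
  · rintro (h | h)
    · exact h.2.1.1 rfl
    · exact h.2.2 rfl
  · rintro (h | h)
    · exact h.2.2 rfl
    · exact h.2.1.1 rfl
  · intro a ha
    exact ha.2.1.2
  · intro b hb
    exact hb.2.1.2
  · refine gc_numeric2 C hC m n _ N _ hnpos hNpos hT ?_
    refine hbound.trans (Nat.mul_le_mul_left _ ?_)
    rw [← hptsc]
    refine hΔc.trans (Nat.mul_le_mul_left _ ?_)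
    rw [← Set.ncard_coe_finset]
    refine Set.ncard_le_ncard ?_ (hTfin.subset ?_)
    · intro z hz
      rw [Finset.mem_coe, Finset.mem_filter] at hz
      obtain ⟨hz1, hz2⟩ := hz
      have hzin : z ∈ Δ := by
        rw [← hz2]
        exact mem_connectedComponentIn (hoff z hz1)
      obtain ⟨p, hp, rfl⟩ := Finset.mem_image.1 hz1
      obtain ⟨⟨h0, h1, h2, h3, h4⟩, hS1, hS2⟩ := hPm p hp
      exact ⟨hzin, p.1, ⟨hS1, h1, h3⟩, p.2, ⟨hS2, h2, h4⟩, hpt p h0.2⟩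
    · rintro z ⟨_, a, ha, b, hb, hab⟩
      refine ⟨a, b, ?_, hab⟩
      rintro rfl
      exact hb.1 ha.1
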